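/- arXiv:math/0012073 — 2 statements merged into one kernel-verified Lean document; each statement's English description precedes it below -/
import Mathlib

section
/- Let H be a Hopf π-coalgebra over a field k and let λ = (λ_α)_{α∈π} be a non-zero left (resp. right) π-integral for H. Then λ_α ≠ 0 for every α ∈ π with H_α ≠ 0; in particular λ_1 ≠ 0. -/
open scoped TensorProduct

noncomputable section

/-- Transport of the algebra structure along an equality of group indices. -/
def gcast (k : Type*) [CommSemiring k] {π : Type*} (H : π → Type*)
    [∀ α, Ring (H α)] [∀ α, Algebra k (H α)] {a b : π} (h : a = b) :
    H a ≃ₐ[k] H b := by subst h; exact AlgEquiv.refl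

/-- Transport of a module family along an equality of group indices. -/
def fcast (k : Type*) [CommSemiring k] {π : Type*} (M : π → Type*)
    [∀ α, AddCommGroup (M α)] [∀ α, Module k (M α)] {a b : π} (h : a = b) :
    M a ≃ₗ[k] M b := by subst h; exact LinearEquiv.refl k (M a)

/-- A Hopf `π`-coalgebra (in the sense of Turaev/Virelizier) over a field `k`:
a family of `k`-algebras `H α` with comultiplication `Δ`, counit `ε` and antipode `S`. -/
class HopfGCoalgebra (k : Type*) [Field k] {π : Type*} [Group π]
    (H : π → Type*) [∀ α, Ring (H α)] [∀ α, Algebra k (H α)] where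
  Δ : ∀ α β : π, H (α * β) →ₐ[k] H α ⊗[k] H β
  ε : H (1 : π) →ₐ[k] k
  S : ∀ α : π, H α →ₗ[k] H α⁻¹
  coassoc : ∀ α β γ : π,
    (TensorProduct.assoc k (H α) (H β) (H γ)).toLinearMap ∘ₗ
        (TensorProduct.map (Δ α β).toLinearMap (LinearMap.id : H γ →ₗ[k] H γ)) ∘ₗ
        (Δ (α * β) γ).toLinearMap
      = (TensorProduct.map (LinearMap.id : H α →ₗ[k] H α) (Δ β γ).toLinearMap) ∘ₗ
        (Δ α (β * γ)).toLinearMap ∘ₗ (gcast k H (mul_assoc α β γ)).toLinearMap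
  counit_right : ∀ α : π,
    (TensorProduct.rid k (H α)).toLinearMap ∘ₗ
        (TensorProduct.map (LinearMap.id : H α →ₗ[k] H α) ε.toLinearMap) ∘ₗ
        (Δ α 1).toLinearMap ∘ₗ (gcast k H (mul_one α).symm).toLinearMap = LinearMap.id
  counit_left : ∀ α : π,
    (TensorProduct.lid k (H α)).toLinearMap ∘ₗ
        (TensorProduct.map ε.toLinearMap (LinearMap.id : H α →ₗ[k] H α)) ∘ₗ
        (Δ 1 α).toLinearMap ∘ₗ (gcast k H (one_mul α).symm).toLinearMap = LinearMap.id
  antipode_left : ∀ α : π,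
    (LinearMap.mul' k (H α)) ∘ₗ
        (TensorProduct.map ((gcast k H (inv_inv α)).toLinearMap ∘ₗ S α⁻¹)
          (LinearMap.id : H α →ₗ[k] H α)) ∘ₗ (Δ α⁻¹ α).toLinearMap
      = (Algebra.linearMap k (H α)) ∘ₗ ε.toLinearMap ∘ₗ
        (gcast k H (inv_mul_cancel α)).toLinearMap
  antipode_right : ∀ α : π,
    (LinearMap.mul' k (H α)) ∘ₗ
        (TensorProduct.map (LinearMap.id : H α →ₗ[k] H α)
          ((gcast k H (inv_inv α)).toLinearMap ∘ₗ S α⁻¹)) ∘ₗ (Δ α α⁻¹).toLinearMap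
      = (Algebra.linearMap k (H α)) ∘ₗ ε.toLinearMap ∘ₗ
        (gcast k H (mul_inv_cancel α)).toLinearMap

namespace HopfGCoalgebra

variable (k : Type*) [Field k] {π : Type*} [Group π] (H : π → Type*)
  [∀ α, Ring (H α)] [∀ α, Algebra k (H α)] [HopfGCoalgebra k H]

/-- A left `π`-integral for `H`. -/
def IsLeftIntegral (lam : ∀ α : π, H α →ₗ[k] k) : Prop :=
  ∀ (α β : π) (x : H (α * β)),
    (TensorProduct.rid k (H α))
        (TensorProduct.map (LinearMap.id : H α →ₗ[k] H α) (lam β) (Δ α β x))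
      = lam (α * β) x • (1 : H α)

/-- A right `π`-integral for `H`. -/
def IsRightIntegral (lam : ∀ α : π, H α →ₗ[k] k) : Prop :=
  ∀ (α β : π) (x : H (α * β)),
    (TensorProduct.lid k (H β))
        (TensorProduct.map (lam α) (LinearMap.id : H β →ₗ[k] H β) (Δ α β x))
      = lam (α * β) x • (1 : H β)

/-- A `π`-grouplike element of `H`. -/
def IsGrouplike (g : ∀ α : π, H α) : Prop :=
  (∀ α β : π, Δ α β (g (α * β)) = g α ⊗ₜ[k] g β) ∧ ε (k := k) (H := H) (g 1) = 1

/-- `g` is the distinguished `π`-grouplike element of `H`. -/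
def IsDistinguishedGrouplike (g : ∀ α : π, H α) : Prop :=
  IsGrouplike k H g ∧
    ∀ lam : ∀ α : π, H α →ₗ[k] k, IsRightIntegral k H lam →
      ∀ (α β : π) (x : H (α * β)),
        (TensorProduct.rid k (H α))
            (TensorProduct.map (LinearMap.id : H α →ₗ[k] H α) (lam β) (Δ α β x))
          = lam (α * β) x • g α

/-- `ν` is the distinguished grouplike element of `H₁*`. -/
def IsDistinguishedNu (ν : H (1 : π) →ₐ[k] k) : Prop :=
  ∀ Λ : H (1 : π), (∀ x : H (1 : π), x * Λ = ε (k := k) (H := H) x • Λ) →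
    ∀ x : H (1 : π), Λ * x = ν x • Λ

/-- The right action `a ↼ f` of `f ∈ H₁*` on `a ∈ H α`. -/
def hitR (f : H (1 : π) →ₗ[k] k) {α : π} (a : H α) : H α :=
  (TensorProduct.lid k (H α))
    (TensorProduct.map f (LinearMap.id : H α →ₗ[k] H α)
      (Δ 1 α ((gcast k H (one_mul α).symm) a)))

/-- The left action `f ⇀ a` of `f ∈ H₁*` on `a ∈ H α`. -/
def hitL (f : H (1 : π) →ₗ[k] k) {α : π} (a : H α) : H α :=
  (TensorProduct.rid k (H α))
    (TensorProduct.map (LinearMap.id : H α →ₗ[k] H α) f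
      (Δ α 1 ((gcast k H (mul_one α).symm) a)))


/-- The comultiplication, with all arguments explicit. -/
def comul (α β : π) : H (α * β) →ₐ[k] H α ⊗[k] H β := Δ α β

/-- The counit, with all arguments explicit. -/
def counit : H (1 : π) →ₐ[k] k := ε

/-- The antipode, with all arguments explicit. -/
def antipode (α : π) : H α →ₗ[k] H α⁻¹ := S α

end HopfGCoalgebra

open HopfGCoalgebra
/-- A right Hopf `π`-comodule over `H`. -/
class HopfGComodule (k : Type*) [Field k] {π : Type*} [Group π]
    (H : π → Type*) [∀ α, Ring (H α)] [∀ α, Algebra k (H α)] [HopfGCoalgebra k H]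
    (M : π → Type*) [∀ α, AddCommGroup (M α)] [∀ α, Module k (M α)] where
  ρ : ∀ α β : π, M (α * β) →ₗ[k] M α ⊗[k] H β
  ρ_coassoc : ∀ α β γ : π,
    (TensorProduct.assoc k (M α) (H β) (H γ)).toLinearMap ∘ₗ
        (TensorProduct.map (ρ α β) (LinearMap.id : H γ →ₗ[k] H γ)) ∘ₗ (ρ (α * β) γ)
      = (TensorProduct.map (LinearMap.id : M α →ₗ[k] M α) (Δ β γ).toLinearMap) ∘ₗ
        (ρ α (β * γ)) ∘ₗ (fcast k M (mul_assoc α β γ)).toLinearMap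
  ρ_counit : ∀ α : π,
    (TensorProduct.rid k (M α)).toLinearMap ∘ₗ
        (TensorProduct.map (LinearMap.id : M α →ₗ[k] M α)
          (ε (k := k) (H := H)).toLinearMap) ∘ₗ
        (ρ α 1) ∘ₗ (fcast k M (mul_one α).symm).toLinearMap = LinearMap.id
  act : ∀ α : π, M α →ₗ[k] H α →ₗ[k] M α
  act_one : ∀ (α : π) (m : M α), act α m 1 = m
  act_mul : ∀ (α : π) (m : M α) (a b : H α), act α (act α m a) b = act α m (a * b)
  ρ_act : ∀ (α β : π) (m : M (α * β)) (a : H (α * β)),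
    ρ α β (act (α * β) m a)
      = TensorProduct.map (TensorProduct.lift (act α)) (LinearMap.mul' k (H β))
          ((TensorProduct.tensorTensorTensorComm k (M α) (H β) (H α) (H β))
            (ρ α β m ⊗ₜ[k] (Δ α β a)))

namespace HopfGComodule

variable (k : Type*) [Field k] {π : Type*} [Group π] (H : π → Type*)
  [∀ α, Ring (H α)] [∀ α, Algebra k (H α)] [HopfGCoalgebra k H]
  (M : π → Type*) [∀ α, AddCommGroup (M α)] [∀ α, Module k (M α)] [HopfGComodule k H M]

/-- The submodule of coinvariant families of `H` on `M`. -/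
def coinvFam : Submodule k (∀ α, M α) where
  carrier := {m | ∀ α β : π, ρ (H := H) α β (m (α * β)) = m α ⊗ₜ[k] (1 : H β)}
  add_mem' := by
    intro a b ha hb α β
    simp only [Pi.add_apply, map_add, ha α β, hb α β, TensorProduct.add_tmul]
  zero_mem' := by
    intro α β
    simp only [Pi.zero_apply, map_zero, TensorProduct.zero_tmul]
  smul_mem' := by
    intro c a ha α β
    simp only [Pi.smul_apply, map_smul, ha α β, TensorProduct.smul_tmul']

/-- The `α`-component of the `π`-subcomodule of coinvariants. -/
def coinvSub (α : π) : Submodule k (M α) :=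
  (coinvFam k H M).map (LinearMap.proj α : (∀ γ, M γ) →ₗ[k] M α)


/-- The comodule structure maps, with all arguments explicit. -/
def coact (α β : π) : M (α * β) →ₗ[k] M α ⊗[k] H β := ρ α β

/-- The right `H α`-action on `M α`, with all arguments explicit. -/
def hact (α : π) : M α →ₗ[k] H α →ₗ[k] M α := act α

end HopfGComodule

section Cosemisimple

variable (k : Type*) [Field k] {π : Type*} [Group π] (H : π → Type*)
  [∀ α, Ring (H α)] [∀ α, Algebra k (H α)]
  (M : π → Type*) [∀ α, AddCommGroup (M α)] [∀ α, Module k (M α)]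

/-- `N` is a `π`-subcomodule of the right `π`-comodule `(M, ρ)` over `H`. -/
def IsGSubcomodule (ρ : ∀ α β : π, M (α * β) →ₗ[k] M α ⊗[k] H β)
    (N : ∀ α, Submodule k (M α)) : Prop :=
  ∀ (α β : π), ∀ x ∈ N (α * β),
    ρ α β x ∈ LinearMap.range
      (TensorProduct.map (N α).subtype (LinearMap.id : H β →ₗ[k] H β))

/-- `N` is a simple `π`-subcomodule of `(M, ρ)`. -/
def IsSimpleGSubcomodule (ρ : ∀ α β : π, M (α * β) →ₗ[k] M α ⊗[k] H β)
    (N : ∀ α, Submodule k (M α)) : Prop :=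
  IsGSubcomodule k H M ρ N ∧ (∃ α, N α ≠ ⊥) ∧
    ∀ P : ∀ α, Submodule k (M α), IsGSubcomodule k H M ρ P → (∀ α, P α ≤ N α) →
      (∀ α, P α = ⊥) ∨ P = N

/-- The right `π`-comodule `(M, ρ)` is cosemisimple: it is the sum of its simple
`π`-subcomodules. -/
def IsGCosemisimple (ρ : ∀ α β : π, M (α * β) →ₗ[k] M α ⊗[k] H β) : Prop :=
  ∀ α : π,
    (⨆ N : {N : ∀ γ, Submodule k (M γ) // IsSimpleGSubcomodule k H M ρ N}, N.1 α) = ⊤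

end Cosemisimple

section CoalgCosemisimple

variable (k : Type*) [Field k] (C : Type*) [AddCommGroup C] [Module k C]

/-- `N` is a subcomodule of the coalgebra `(C, δ)` viewed as a right comodule over itself. -/
def IsSubcoideal (δ : C →ₗ[k] C ⊗[k] C) (N : Submodule k C) : Prop :=
  ∀ x ∈ N, δ x ∈ LinearMap.range (TensorProduct.map N.subtype (LinearMap.id : C →ₗ[k] C))

def IsSimpleSubcoideal (δ : C →ₗ[k] C ⊗[k] C) (N : Submodule k C) : Prop :=
  IsSubcoideal k C δ N ∧ N ≠ ⊥ ∧
    ∀ P : Submodule k C, IsSubcoideal k C δ P → P ≤ N → P = ⊥ ∨ P = N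

/-- The coalgebra `(C, δ)` is cosemisimple. -/
def IsCosemisimpleCoalgebra (δ : C →ₗ[k] C ⊗[k] C) : Prop :=
  (⨆ N : {N : Submodule k C // IsSimpleSubcoideal k C δ N}, N.1) = ⊤

end CoalgCosemisimple
/-- A crossed Hopf `π`-coalgebra: a Hopf `π`-coalgebra with a crossing `φ`. -/
class CrossedHopfGCoalgebra (k : Type*) [Field k] {π : Type*} [Group π]
    (H : π → Type*) [∀ α, Ring (H α)] [∀ α, Algebra k (H α)]
    extends HopfGCoalgebra k H where
  φ : ∀ β α : π, H α ≃ₐ[k] H (β * α * β⁻¹)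
  φ_comul : ∀ β α γ : π,
    (TensorProduct.map (φ β α).toLinearMap (φ β γ).toLinearMap) ∘ₗ (Δ α γ).toLinearMap
      = (Δ (β * α * β⁻¹) (β * γ * β⁻¹)).toLinearMap ∘ₗ
        (gcast k H (show β * (α * γ) * β⁻¹ = (β * α * β⁻¹) * (β * γ * β⁻¹) by
          group)).toLinearMap ∘ₗ (φ β (α * γ)).toLinearMap
  φ_counit : ∀ (β : π) (x : H (1 : π)),
    ε ((gcast k H (show β * 1 * β⁻¹ = (1 : π) by group)) (φ β 1 x)) = ε x
  φ_mul : ∀ (β β' α : π) (x : H α),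
    (gcast k H (show β * (β' * α * β'⁻¹) * β⁻¹ = (β * β') * α * (β * β')⁻¹ by group))
        (φ β (β' * α * β'⁻¹) (φ β' α x))
      = φ (β * β') α x


namespace CrossedHopfGCoalgebra

variable (k : Type*) [Field k] {π : Type*} [Group π] (H : π → Type*)
  [∀ α, Ring (H α)] [∀ α, Algebra k (H α)] [CrossedHopfGCoalgebra k H]

/-- The crossing, with all arguments explicit. -/
def crossing (β α : π) : H α ≃ₐ[k] H (β * α * β⁻¹) := φ β α

end CrossedHopfGCoalgebra

open CrossedHopfGCoalgebra

/-- A quasitriangular Hopf `π`-coalgebra: a crossed Hopf `π`-coalgebra with an R-matrix. -/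
class QTHopfGCoalgebra (k : Type*) [Field k] {π : Type*} [Group π]
    (H : π → Type*) [∀ α, Ring (H α)] [∀ α, Algebra k (H α)]
    extends CrossedHopfGCoalgebra k H where
  Rm : ∀ α β : π, H α ⊗[k] H β
  Rm_isUnit : ∀ α β : π, IsUnit (Rm α β)
  Rm_comul : ∀ (α β : π) (x : H (α * β)),
    Rm α β * Δ α β x
      = (TensorProduct.comm k (H β) (H α))
          ((TensorProduct.map
              ((gcast k H (show α⁻¹ * (α * β * α⁻¹) * α⁻¹⁻¹ = β by group)).toLinearMap ∘ₗ
                (φ α⁻¹ (α * β * α⁻¹)).toLinearMap)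
              (LinearMap.id : H α →ₗ[k] H α))
            ((Δ (α * β * α⁻¹) α)
              ((gcast k H (show α * β = (α * β * α⁻¹) * α by group)) x))) * Rm α β
  Rm_delta_right : ∀ α β γ : π,
    TensorProduct.map (LinearMap.id : H α →ₗ[k] H α) (Δ β γ).toLinearMap (Rm α (β * γ))
      = (TensorProduct.map (LinearMap.id : H α →ₗ[k] H α)
            (TensorProduct.mk k (H β) (H γ) 1) (Rm α γ))
        * (TensorProduct.map (LinearMap.id : H α →ₗ[k] H α)
            ((TensorProduct.mk k (H β) (H γ)).flip 1) (Rm α β))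
  Rm_delta_left : ∀ α β γ : π,
    (TensorProduct.assoc k (H α) (H β) (H γ))
        (TensorProduct.map (Δ α β).toLinearMap (LinearMap.id : H γ →ₗ[k] H γ)
          (Rm (α * β) γ))
      = (TensorProduct.map (LinearMap.id : H α →ₗ[k] H α)
            (TensorProduct.mk k (H β) (H γ) 1)
            (TensorProduct.map (LinearMap.id : H α →ₗ[k] H α)
              ((gcast k H (show β⁻¹ * (β * γ * β⁻¹) * β⁻¹⁻¹ = γ by group)).toLinearMap ∘ₗ
                (φ β⁻¹ (β * γ * β⁻¹)).toLinearMap)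
              (Rm α (β * γ * β⁻¹))))
        * (TensorProduct.mk k (H α) (H β ⊗[k] H γ) 1 (Rm β γ))
  Rm_phi : ∀ β α γ : π,
    TensorProduct.map (φ β α).toLinearMap (φ β γ).toLinearMap (Rm α γ)
      = Rm (β * α * β⁻¹) (β * γ * β⁻¹)

namespace QTHopfGCoalgebra

variable (k : Type*) [Field k] {π : Type*} [Group π] (H : π → Type*)
  [∀ α, Ring (H α)] [∀ α, Algebra k (H α)] [QTHopfGCoalgebra k H]

/-- The square of the antipode `S_{α⁻¹} ∘ S_α : H α → H α`. -/
def antipodeSq (α : π) : H α →ₗ[k] H α :=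
  (gcast k H (inv_inv α)).toLinearMap ∘ₗ S α⁻¹ ∘ₗ S α

/-- The map `S_{α⁻¹} ∘ φ_α : H (α⁻¹) → H α`. -/
def sphi (α : π) : H α⁻¹ →ₗ[k] H α :=
  (gcast k H (inv_inv α)).toLinearMap ∘ₗ S α⁻¹ ∘ₗ
    (gcast k H (show α * α⁻¹ * α⁻¹ = α⁻¹ by group)).toLinearMap ∘ₗ
    (φ α α⁻¹).toLinearMap

/-- The Drinfeld element `u_α = m_α ∘ (S_{α⁻¹}φ_α ⊗ id) ∘ σ_{α,α⁻¹} (R_{α,α⁻¹})`. -/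
def drinfeld (α : π) : H α :=
  LinearMap.mul' k (H α)
    (TensorProduct.map (sphi k H α) (LinearMap.id : H α →ₗ[k] H α)
      ((TensorProduct.comm k (H α) (H α⁻¹)) (Rm α α⁻¹)))

/-- The element `S_{α⁻¹}(u_{α⁻¹}) ∈ H α`. -/
def sdrinfeld (α : π) : H α :=
  (gcast k H (inv_inv α)) (S (k := k) (H := H) α⁻¹ (drinfeld k H α⁻¹))

/-- The `π`-grouplike element `ℓ_α = S_{α⁻¹}(u_{α⁻¹})⁻¹ u_α`. -/
def ell (α : π) : H α :=
  Ring.inverse (sdrinfeld k H α) * drinfeld k H α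


/-- The R-matrix, with all arguments explicit. -/
def rmatrix (α β : π) : H α ⊗[k] H β := Rm α β

end QTHopfGCoalgebra

open QTHopfGCoalgebra

namespace HopfGCoalgebra

/-- If `H α` is non-zero then so is `H α⁻¹`, by the antipode axiom. -/
theorem nontrivial_inv (k : Type*) [Field k] {π : Type*} [Group π] (H : π → Type*)
    [∀ α, Ring (H α)] [∀ α, Algebra k (H α)] [HopfGCoalgebra k H] (α : π) [Nontrivial (H α)] :
    Nontrivial (H α⁻¹) := by
  by_contra h
  rw [not_nontrivial_iff_subsingleton] at h
  have key := LinearMap.congr_fun (antipode_left (k := k) (H := H) α) 1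
  have hz : (Δ (k := k) (H := H) α⁻¹ α) 1 = 0 := Subsingleton.elim _ _
  simp [hz, -map_one] at key
  simp at key

section Integrals

variable {k : Type*} [Field k] {π : Type*} [Group π] {H : π → Type*}
  [∀ α, Ring (H α)] [∀ α, Algebra k (H α)] [HopfGCoalgebra k H]

/-- If the component of a left integral at `β` vanishes, so does the one at `α * β`
whenever `H α` is non-zero. -/
theorem IsLeftIntegral.eq_zero_mul {lam : ∀ α : π, H α →ₗ[k] k}
    (hl : IsLeftIntegral k H lam) (α β : π) [Nontrivial (H α)] (h : lam β = 0) :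
    lam (α * β) = 0 := by
  ext x
  simpa [h] using (hl α β x).symm

/-- If the component of a right integral at `α` vanishes, so does the one at `α * β`
whenever `H β` is non-zero. -/
theorem IsRightIntegral.eq_zero_mul {lam : ∀ α : π, H α →ₗ[k] k}
    (hr : IsRightIntegral k H lam) (α β : π) [Nontrivial (H β)] (h : lam α = 0) :
    lam (α * β) = 0 := by
  ext x
  simpa [h] using (hr α β x).symm

/-- If the component at `1` of an integral vanishes, so do all components. -/
theorem integral_eq_zero_of_one {lam : ∀ α : π, H α →ₗ[k] k}
    (hint : IsLeftIntegral k H lam ∨ IsRightIntegral k H lam) (h : lam 1 = 0) (β : π) :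
    lam β = 0 := by
  rcases subsingleton_or_nontrivial (H β) with _ | _
  · exact Subsingleton.elim _ _
  · rcases hint with hl | hr
    · exact mul_one β ▸ hl.eq_zero_mul β 1 h
    · exact one_mul β ▸ hr.eq_zero_mul 1 β h

/-- If the component of an integral at `α` vanishes and `H α` is non-zero, then the component
at `1` vanishes. -/
theorem integral_one_eq_zero {lam : ∀ α : π, H α →ₗ[k] k}
    (hint : IsLeftIntegral k H lam ∨ IsRightIntegral k H lam) (α : π) [Nontrivial (H α)]
    (h : lam α = 0) : lam 1 = 0 := by
  have := nontrivial_inv k H α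
  rcases hint with hl | hr
  · exact inv_mul_cancel α ▸ hl.eq_zero_mul α⁻¹ α h
  · exact mul_inv_cancel α ▸ hr.eq_zero_mul α α⁻¹ h

end Integrals

end HopfGCoalgebra

/-- Lemma 3.1: a non-zero left (resp. right) `π`-integral has non-zero component `λ_α`
for every `α` with `H_α ≠ 0`; in particular `λ_1 ≠ 0`. -/
theorem integral_components_nonzero (k : Type*) [Field k] {π : Type*} [Group π]
    (H : π → Type*) [∀ α, Ring (H α)] [∀ α, Algebra k (H α)] [HopfGCoalgebra k H]
    (lam : ∀ α : π, H α →ₗ[k] k)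
    (hint : IsLeftIntegral k H lam ∨ IsRightIntegral k H lam)
    (hnz : ∃ β : π, lam β ≠ 0) :
    (∀ α : π, Nontrivial (H α) → lam α ≠ 0) ∧ lam 1 ≠ 0 := by
  obtain ⟨β, hβ⟩ := hnz
  have hone : lam 1 ≠ 0 := fun h => hβ (integral_eq_zero_of_one hint h β)
  exact ⟨fun α _ h => hone (integral_one_eq_zero hint α h), hone⟩
end
end

section
/- Let H be a Hopf π-coalgebra over a field k. If there exists a non-zero left π-integral for H, then the antipode component S_α : H_α → H_{α⁻¹} is injective for every α ∈ π. -/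
open scoped TensorProduct

noncomputable section

open HopfGCoalgebra
open CrossedHopfGCoalgebra

open QTHopfGCoalgebra

namespace HopfGCoalgebra

section Convolution

variable {k : Type*} [Field k] {π : Type*} {H : π → Type*}
  [∀ α, Ring (H α)] [∀ α, Algebra k (H α)]

theorem gcast_gcast_symm {a b : π} (h : a = b) (x : H b) :
    gcast k H h (gcast k H h.symm x) = x := by
  subst h
  rfl

variable [Group π] [HopfGCoalgebra k H]

variable (k H) in
/-- The comultiplication `H c → H a ⊗ H b` attached to a factorization `a * b = c`. -/
def comulOf {a b c : π} (h : a * b = c) : H c →ₐ[k] H a ⊗[k] H b :=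
  (Δ a b).comp (gcast k H h.symm).toAlgHom

variable (k H) in
/-- The antipode as a map `H a → H b` whenever `a * b = 1`. -/
def antipodeOf {a b : π} (h : a * b = 1) : H a →ₗ[k] H b :=
  (gcast k H (inv_eq_of_mul_eq_one_right h)).toLinearMap ∘ₗ S a

theorem comulOf_coassoc {a b c ab bc abc : π} (hab : a * b = ab) (hbc : b * c = bc)
    (h₁ : ab * c = abc) (h₂ : a * bc = abc) (x : H abc) :
    TensorProduct.assoc k (H a) (H b) (H c)
        (TensorProduct.map (comulOf k H hab).toLinearMap LinearMap.id (comulOf k H h₁ x))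
      = TensorProduct.map LinearMap.id (comulOf k H hbc).toLinearMap (comulOf k H h₂ x) := by
  subst hab hbc h₁
  exact LinearMap.congr_fun (coassoc (k := k) (H := H) a b c) x

/-- The convolution of `f : H a → A` and `g : H b → A`, a map on `H c` for `a * b = c`. -/
def conv {A : Type*} [Ring A] [Algebra k A] {a b c : π} (h : a * b = c)
    (f : H a →ₗ[k] A) (g : H b →ₗ[k] A) : H c →ₗ[k] A :=
  LinearMap.mul' k A ∘ₗ TensorProduct.map f g ∘ₗ (comulOf k H h).toLinearMap

variable (k H) in
/-- The unit of the convolution product, `x ↦ ε(x) 1`. -/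
def convOne (A : Type*) [Ring A] [Algebra k A] : H (1 : π) →ₗ[k] A :=
  Algebra.linearMap k A ∘ₗ (ε (k := k) (H := H)).toLinearMap

variable {A B : Type*} [Ring A] [Algebra k A] [Ring B] [Algebra k B]

theorem conv_apply {a b c : π} (h : a * b = c) (f : H a →ₗ[k] A) (g : H b →ₗ[k] A) (x : H c) :
    conv h f g x = LinearMap.mul' k A (TensorProduct.map f g (comulOf k H h x)) := rfl

theorem conv_assoc {a b c ab bc abc : π} (hab : a * b = ab) (hbc : b * c = bc)
    (h₁ : ab * c = abc) (h₂ : a * bc = abc)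
    (f : H a →ₗ[k] A) (g : H b →ₗ[k] A) (l : H c →ₗ[k] A) :
    conv h₁ (conv hab f g) l = conv h₂ f (conv hbc g l) := by
  ext x
  have key := congrArg (LinearMap.mul' k A ∘ₗ TensorProduct.map f
    (LinearMap.mul' k A ∘ₗ TensorProduct.map g l)) (comulOf_coassoc (k := k) hab hbc h₁ h₂ x)
  have left : ∀ u : H ab ⊗[k] H c,
      LinearMap.mul' k A (TensorProduct.map (conv hab f g) l u)
        = (LinearMap.mul' k A ∘ₗ TensorProduct.map f
            (LinearMap.mul' k A ∘ₗ TensorProduct.map g l))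
          (TensorProduct.assoc k (H a) (H b) (H c)
            (TensorProduct.map (comulOf k H hab).toLinearMap LinearMap.id u)) := by
    intro u
    induction u with
    | zero => simp
    | add u v hu hv => simp only [map_add, hu, hv]
    | tmul p q =>
      simp only [TensorProduct.map_tmul, conv_apply, LinearMap.mul'_apply, LinearMap.id_coe, id_eq,
        AlgHom.toLinearMap_apply]
      induction comulOf k H hab p with
      | zero => simp
      | add u v hu hv => simp only [map_add, TensorProduct.add_tmul, add_mul, hu, hv]
      | tmul p q => simp [mul_assoc]
  have right : ∀ u : H a ⊗[k] H bc,
      LinearMap.mul' k A (TensorProduct.map f (conv hbc g l) u)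
        = (LinearMap.mul' k A ∘ₗ TensorProduct.map f
            (LinearMap.mul' k A ∘ₗ TensorProduct.map g l))
            (TensorProduct.map LinearMap.id (comulOf k H hbc).toLinearMap u) := by
    intro u
    induction u with
    | zero => simp
    | add u v hu hv => simp only [map_add, hu, hv]
    | tmul p q => simp [conv_apply]
  rw [conv_apply, conv_apply, left, right, key]

theorem conv_convOne {a : π} (h : a * 1 = a) (f : H a →ₗ[k] A) :
    conv h f (convOne k H A) = f := by
  ext x
  have key := congrArg f (LinearMap.congr_fun (counit_right (k := k) (H := H) a) x)
  rw [LinearMap.id_apply] at key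
  conv_rhs => rw [← key]
  change _ = f (TensorProduct.rid k (H a)
    (TensorProduct.map LinearMap.id (ε (k := k) (H := H)).toLinearMap (comulOf k H h x)))
  rw [conv_apply]
  induction comulOf k H h x with
  | zero => simp
  | add u v hu hv => simp only [map_add, hu, hv]
  | tmul p q => simp [convOne, ← Algebra.commutes, ← Algebra.smul_def]

theorem convOne_conv {a : π} (h : 1 * a = a) (f : H a →ₗ[k] A) :
    conv h (convOne k H A) f = f := by
  ext x
  have key := congrArg f (LinearMap.congr_fun (counit_left (k := k) (H := H) a) x)
  rw [LinearMap.id_apply] at key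
  conv_rhs => rw [← key]
  change _ = f (TensorProduct.lid k (H a)
    (TensorProduct.map (ε (k := k) (H := H)).toLinearMap LinearMap.id (comulOf k H h x)))
  rw [conv_apply]
  induction comulOf k H h x with
  | zero => simp
  | add u v hu hv => simp only [map_add, hu, hv]
  | tmul p q => simp [convOne, ← Algebra.smul_def]

theorem comp_conv (D : A →ₐ[k] B) {a b c : π} (h : a * b = c)
    (f : H a →ₗ[k] A) (g : H b →ₗ[k] A) :
    D.toLinearMap ∘ₗ conv h f g = conv h (D.toLinearMap ∘ₗ f) (D.toLinearMap ∘ₗ g) := by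
  ext x
  simp only [LinearMap.comp_apply, conv_apply]
  induction comulOf k H h x with
  | zero => simp
  | add u v hu hv => simp only [map_add, hu, hv]
  | tmul p q => simp

theorem comp_convOne (D : A →ₐ[k] B) :
    D.toLinearMap ∘ₗ convOne k H A = convOne k H B := by
  ext x
  simp [convOne]

theorem antipodeOf_conv_id {a b : π} (h : a * b = 1) :
    conv h (antipodeOf k H h) LinearMap.id = convOne k H (H b) := by
  obtain rfl : a = b⁻¹ := eq_inv_of_mul_eq_one_left h
  ext x
  have key := LinearMap.congr_fun (antipode_left (k := k) (H := H) b)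
    (gcast k H (inv_mul_cancel b).symm x)
  refine Eq.trans key ?_
  simp only [LinearMap.comp_apply, AlgEquiv.toLinearMap_apply, gcast_gcast_symm]
  rfl

theorem id_conv_antipodeOf {a b : π} (h : a * b = 1) (h' : b * a = 1) :
    conv h LinearMap.id (antipodeOf k H h') = convOne k H (H a) := by
  obtain rfl : b = a⁻¹ := eq_inv_of_mul_eq_one_left h'
  ext x
  have key := LinearMap.congr_fun (antipode_right (k := k) (H := H) a)
    (gcast k H (mul_inv_cancel a).symm x)
  refine Eq.trans key ?_
  simp only [LinearMap.comp_apply, AlgEquiv.toLinearMap_apply, gcast_gcast_symm]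
  rfl

theorem includeLeft_conv_includeRight {a b c : π} (h : a * b = c) :
    conv h (Algebra.TensorProduct.includeLeft : H a →ₐ[k] H a ⊗[k] H b).toLinearMap
      (Algebra.TensorProduct.includeRight : H b →ₐ[k] H a ⊗[k] H b).toLinearMap
      = (comulOf k H h).toLinearMap := by
  ext x
  rw [conv_apply, AlgHom.toLinearMap_apply]
  induction comulOf k H h x with
  | zero => simp
  | add u v hu hv => simp only [map_add, hu, hv]
  | tmul p q => simp

/-- The antipode reverses the comultiplication: `Δ(S x) = S x₂ ⊗ S x₁`. -/
theorem comulOf_comp_antipodeOf {a b c a' b' c' : π} (h : a * b = c) (h' : b' * a' = c')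
    (ha : a * a' = 1) (hb : b * b' = 1) (hc : c * c' = 1) :
    (comulOf k H h').toLinearMap ∘ₗ antipodeOf k H hc
      = conv h
        ((Algebra.TensorProduct.includeRight : H a' →ₐ[k] H b' ⊗[k] H a').toLinearMap ∘ₗ
          antipodeOf k H ha)
        ((Algebra.TensorProduct.includeLeft : H b' →ₐ[k] H b' ⊗[k] H a').toLinearMap ∘ₗ
          antipodeOf k H hb) := by
  set ι₁ := (Algebra.TensorProduct.includeLeft : H b' →ₐ[k] H b' ⊗[k] H a') with hι₁
  set ι₂ := (Algebra.TensorProduct.includeRight : H a' →ₐ[k] H b' ⊗[k] H a') with hι₂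
  have ha' : a' * a = 1 := mul_eq_one_comm.mp ha
  have hb' : b' * b = 1 := mul_eq_one_comm.mp hb
  have hc' : c' * c = 1 := mul_eq_one_comm.mp hc
  have e₁ : a' * c = b := by rw [← h, ← mul_assoc, ha', one_mul]
  have right_inv : conv hc' (comulOf k H h').toLinearMap
      (conv h (ι₂.toLinearMap ∘ₗ antipodeOf k H ha) (ι₁.toLinearMap ∘ₗ antipodeOf k H hb))
      = convOne k H (H b' ⊗[k] H a') := by
    rw [← includeLeft_conv_includeRight h', conv_assoc h' e₁ hc' hb',
      ← conv_assoc ha' h (one_mul b) e₁]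
    have e₂ := comp_conv ι₂ ha' LinearMap.id (antipodeOf k H ha)
    rw [LinearMap.comp_id, id_conv_antipodeOf, comp_convOne] at e₂
    have e₃ := comp_conv ι₁ hb' LinearMap.id (antipodeOf k H hb)
    rw [LinearMap.comp_id, id_conv_antipodeOf, comp_convOne] at e₃
    rw [← e₂, convOne_conv, ← e₃]
  have left_inv : conv hc ((comulOf k H h').toLinearMap ∘ₗ antipodeOf k H hc)
      (comulOf k H h').toLinearMap = convOne k H (H b' ⊗[k] H a') := by
    have e₂ := comp_conv (comulOf k H h') hc (antipodeOf k H hc) LinearMap.id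
    rwa [LinearMap.comp_id, antipodeOf_conv_id, comp_convOne, eq_comm] at e₂
  rw [← conv_convOne (mul_one c) ((comulOf k H h').toLinearMap ∘ₗ antipodeOf k H hc), ← right_inv,
    ← conv_assoc hc hc' (one_mul c) (mul_one c), left_inv, convOne_conv]

theorem counit_comp_antipodeOf (h : (1 : π) * 1 = 1) :
    (ε (k := k) (H := H)).toLinearMap ∘ₗ antipodeOf k H h
      = (ε (k := k) (H := H)).toLinearMap := by
  have e : convOne k H k = (ε (k := k) (H := H)).toLinearMap := by ext x; simp [convOne]
  have key := comp_conv (ε (k := k) (H := H)) h (antipodeOf k H h) LinearMap.id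
  rw [LinearMap.comp_id, antipodeOf_conv_id, comp_convOne] at key
  rw [e] at key
  conv_rhs at key => rw [← e]
  rwa [conv_convOne, eq_comm] at key

/-- The identity `S²(x₂) S(x₁) = ε(x) 1`. -/
theorem op_antipodeOf_conv_op_antipodeOf_antipodeOf {a b : π} (h : a * b = 1) (h' : b * a = 1) :
    conv h ((MulOpposite.opLinearEquiv k).toLinearMap ∘ₗ antipodeOf k H h)
      ((MulOpposite.opLinearEquiv k).toLinearMap ∘ₗ antipodeOf k H h ∘ₗ antipodeOf k H h')
      = convOne k H (H b)ᵐᵒᵖ := by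
  ext x
  have e₁ := LinearMap.congr_fun (antipodeOf_conv_id (k := k) (H := H) h)
    (antipodeOf k H (one_mul 1) x)
  have e₂ := LinearMap.congr_fun
    (comulOf_comp_antipodeOf (k := k) (H := H) h h h h' (one_mul 1)) x
  have e₃ := LinearMap.congr_fun (counit_comp_antipodeOf (k := k) (H := H) (one_mul 1)) x
  simp only [LinearMap.comp_apply, AlgHom.toLinearMap_apply] at e₂ e₃
  simp only [convOne, LinearMap.comp_apply, AlgHom.toLinearMap_apply, conv_apply, e₃] at e₁
  rw [e₂] at e₁
  have e₄ := congrArg MulOpposite.op e₁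
  simp only [Algebra.linearMap_apply] at e₄
  simp only [convOne, LinearMap.comp_apply, AlgHom.toLinearMap_apply, Algebra.linearMap_apply,
    MulOpposite.algebraMap_apply]
  rw [← e₄, conv_apply, conv_apply]
  induction comulOf k H h x with
  | zero => simp
  | add u v hu hv => simp only [map_add, hu, hv, MulOpposite.op_add]
  | tmul p q => simp

end Convolution

section Integral

variable {k : Type*} [Field k] {π : Type*} [Group π] {H : π → Type*}
  [∀ α, Ring (H α)] [∀ α, Algebra k (H α)] [HopfGCoalgebra k H]
  {lam : ∀ α : π, H α →ₗ[k] k}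

theorem IsLeftIntegral.comulOf (hint : IsLeftIntegral k H lam) {a b c : π} (h : a * b = c)
    (x : H c) :
    TensorProduct.rid k (H a)
        (TensorProduct.map LinearMap.id (lam b) (HopfGCoalgebra.comulOf k H h x))
      = lam c x • (1 : H a) := by
  subst h
  exact hint a b x

/-- The map `z ↦ y₁ λ(y₂ z)`. -/
def integralTwist (lam : ∀ α : π, H α →ₗ[k] k) {a b c : π} (h : a * b = c) (y : H c) :
    H b →ₗ[k] H a :=
  (TensorProduct.rid k (H a)).toLinearMap ∘ₗ TensorProduct.map LinearMap.id (lam b) ∘ₗ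
    LinearMap.mulLeft k (comulOf k H h y) ∘ₗ
    (Algebra.TensorProduct.includeRight : H b →ₐ[k] H a ⊗[k] H b).toLinearMap

/-- The identity `λ(y S(x₁)) x₂ = y₁ λ(y₂ S(x))` for a left integral `λ`. -/
theorem IsLeftIntegral.conv_antipodeOf_id (hint : IsLeftIntegral k H lam) {a a' b b' c : π}
    (ha : a * a' = 1) (hb : b' * b = 1) (h : b' * c = a) (h' : c * a' = b) (y : H b) :
    conv h (Algebra.linearMap k (H c) ∘ₗ lam b ∘ₗ LinearMap.mulLeft k y ∘ₗ antipodeOf k H hb)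
      LinearMap.id = integralTwist lam h' y ∘ₗ antipodeOf k H ha := by
  have hc : c⁻¹ * c = 1 := inv_mul_cancel c
  have e : a * c⁻¹ = b' := by rw [← h, mul_assoc, mul_inv_cancel, mul_one]
  have key : Algebra.linearMap k (H c) ∘ₗ lam b ∘ₗ LinearMap.mulLeft k y ∘ₗ antipodeOf k H hb
      = conv e (integralTwist lam h' y ∘ₗ antipodeOf k H ha) (antipodeOf k H hc) := by
    ext w
    have e₁ := LinearMap.congr_fun (comulOf_comp_antipodeOf (k := k) (H := H) e h' ha hc hb) w
    simp only [LinearMap.comp_apply, AlgHom.toLinearMap_apply] at e₁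
    have e₂ := hint.comulOf h' (y * antipodeOf k H hb w)
    simp only [LinearMap.comp_apply, Algebra.linearMap_apply, LinearMap.mulLeft_apply,
      Algebra.algebraMap_eq_smul_one]
    rw [← e₂, map_mul, e₁, conv_apply, conv_apply]
    induction HopfGCoalgebra.comulOf k H e w with
    | zero => simp
    | add u v hu hv => simp only [map_add, mul_add, hu, hv]
    | tmul p q =>
      simp only [integralTwist, TensorProduct.map_tmul, LinearMap.mul'_apply, LinearMap.comp_apply,
        LinearMap.mulLeft_apply, AlgHom.toLinearMap_apply, LinearEquiv.coe_coe]
      induction HopfGCoalgebra.comulOf k H h' y with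
      | zero => simp
      | add u v hu hv => simp only [map_add, add_mul, hu, hv]
      | tmul r s => simp
  rw [key, conv_assoc e hc h (mul_one a), antipodeOf_conv_id, conv_convOne]

/-- If `λ(y S(x₁)) x₂ = 0` for all `y`, then `λ(y) x = 0` for all `y`. -/
theorem smul_eq_zero_of_conv_antipodeOf_eq_zero {a b b' c : π} (l : H b →ₗ[k] k)
    (hb : b' * b = 1) (h : b' * c = a) (h' : b * a = c) (x : H a)
    (hx : ∀ y : H b, conv h
      (Algebra.linearMap k (H c) ∘ₗ l ∘ₗ LinearMap.mulLeft k y ∘ₗ antipodeOf k H hb)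
      LinearMap.id x = 0) (y : H b) :
    l y • x = 0 := by
  have hb' : b * b' = 1 := mul_eq_one_comm.mp hb
  let j : (H b)ᵐᵒᵖ →ₐ[k] (H b)ᵐᵒᵖ ⊗[k] H a := Algebra.TensorProduct.includeLeft
  let i : H a →ₐ[k] (H b)ᵐᵒᵖ ⊗[k] H a := Algebra.TensorProduct.includeRight
  let op : H b →ₗ[k] (H b)ᵐᵒᵖ := (MulOpposite.opLinearEquiv k).toLinearMap
  let R : H c →ₗ[k] (H b)ᵐᵒᵖ ⊗[k] H a :=
    conv h' (j.toLinearMap ∘ₗ op ∘ₗ antipodeOf k H hb ∘ₗ antipodeOf k H hb') i.toLinearMap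
  let θ : (H b)ᵐᵒᵖ ⊗[k] H a →ₗ[k] H a :=
    (TensorProduct.lid k (H a)).toLinearMap ∘ₗ TensorProduct.map
      (l ∘ₗ LinearMap.mulLeft k y ∘ₗ (MulOpposite.opLinearEquiv k).symm.toLinearMap) LinearMap.id
  have hR : conv h (j.toLinearMap ∘ₗ op ∘ₗ antipodeOf k H hb) R = i.toLinearMap := by
    rw [← conv_assoc hb h' (one_mul a) h]
    have e := comp_conv j hb (op ∘ₗ antipodeOf k H hb)
      (op ∘ₗ antipodeOf k H hb ∘ₗ antipodeOf k H hb')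
    rw [op_antipodeOf_conv_op_antipodeOf_antipodeOf, comp_convOne] at e
    rw [← e, convOne_conv]
  have hθ : θ (i x) = l y • x := by simp [θ, i]
  rw [← hθ, ← AlgHom.toLinearMap_apply i, ← hR]
  set E : H b ⊗[k] H c :=
    TensorProduct.map (antipodeOf k H hb) LinearMap.id (comulOf k H h x) with hE
  have hRE : conv h (j.toLinearMap ∘ₗ op ∘ₗ antipodeOf k H hb) R x
      = LinearMap.mul' k _ (TensorProduct.map (j.toLinearMap ∘ₗ op) R E) := by
    rw [hE, conv_apply]
    induction comulOf k H h x with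
    | zero => simp
    | add u v hu hv => simp only [map_add, hu, hv]
    | tmul p q => simp
  have hxE : ∀ z : H b, TensorProduct.lid k (H c)
      (TensorProduct.map (l ∘ₗ LinearMap.mulLeft k z) LinearMap.id E) = 0 := by
    intro z
    rw [← hx z, hE, conv_apply]
    induction comulOf k H h x with
    | zero => simp
    | add u v hu hv => simp only [map_add, hu, hv]
    | tmul p q => simp [Algebra.smul_def]
  rw [hRE]
  clear_value E
  classical
  let 𝒞 := Module.Basis.ofVectorSpace k (H c)
  obtain ⟨e, rfl⟩ := (TensorProduct.equivFinsuppOfBasisRight (M := H b) 𝒞).symm.surjective E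
  rw [TensorProduct.equivFinsuppOfBasisRight_symm_apply] at hxE ⊢
  have he : ∀ n (z : H b), l (z * e n) = 0 := by
    intro n z
    by_cases hn : e n = 0
    · simp [hn]
    have := congrArg (fun v => 𝒞.repr v n) (hxE z)
    simpa [Finsupp.sum, map_sum, Finsupp.single_apply, hn] using this
  simp only [Finsupp.sum, map_sum]
  refine Finset.sum_eq_zero fun n _ => ?_
  simp only [TensorProduct.map_tmul, LinearMap.mul'_apply]
  induction R (𝒞 n) with
  | zero => simp
  | add u v hu hv => simp only [mul_add, map_add, hu, hv, add_zero]
  | tmul r s => simp [θ, j, op, ← mul_assoc, he]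

end Integral

end HopfGCoalgebra

/-- Lemma 3.2: if `H` has a non-zero left `π`-integral, then each antipode component
`S_α` is injective. -/
theorem antipode_injective_of_exists_integral (k : Type*) [Field k] {π : Type*} [Group π]
    (H : π → Type*) [∀ α, Ring (H α)] [∀ α, Algebra k (H α)] [HopfGCoalgebra k H]
    (lam : ∀ α : π, H α →ₗ[k] k) (hint : IsLeftIntegral k H lam)
    (hnz : ∃ β : π, lam β ≠ 0) :
    ∀ α : π, Function.Injective (antipode k H α) := by
  intro α
  obtain ⟨β, hβ⟩ := hnz
  obtain ⟨y, hy⟩ : ∃ y, lam β y ≠ 0 := by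
    by_contra! hzero
    exact hβ (LinearMap.ext hzero)
  refine (injective_iff_map_eq_zero _).mpr fun x hx => ?_
  have hSx : antipodeOf k H (mul_inv_cancel α) x = 0 := by
    have hS : S (k := k) (H := H) α x = 0 := hx
    rw [antipodeOf, LinearMap.comp_apply, hS, map_zero]
  have h : β⁻¹ * (β * α) = α := inv_mul_cancel_left β α
  refine (smul_eq_zero.mp (smul_eq_zero_of_conv_antipodeOf_eq_zero (lam β) (inv_mul_cancel β)
    h rfl x (fun z => ?_) y)).resolve_left hy
  rw [hint.conv_antipodeOf_id (mul_inv_cancel α) (inv_mul_cancel β) h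
    (mul_inv_cancel_right β α) z, LinearMap.comp_apply, hSx, map_zero]
end
end
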